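/- Let W' be a reflection subgroup of W, let i ∈ {1,2}, and let w ∈ W'. Then N_i(w) ∩ Φ̂_i(W') = {x̂ ∈ Φ̂_i(W') : ℓ_{W'}(w·r_x) < ℓ_{W'}(w)}. -/

import Mathlib

open Pointwise

/-- The positive linear cone of a subset `A` of a real vector space: finite linear
combinations of elements of `A` with all coefficients nonnegative and at least one
strictly positive. -/
def PLC {V : Type*} [AddCommGroup V] [Module ℝ V] (A : Set V) : Set V :=
  { v | ∃ c : V →₀ ℝ, (∀ a, 0 ≤ c a) ∧ ↑c.support ⊆ A ∧ c ≠ 0 ∧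
          v = c.sum fun a t => t • a }

/-- `altEnd a b m` is the alternating product `⋯ a b a b` … of `m` factors,
ending with `b` (e.g. `altEnd a b 3 = b * a * b`). -/
def altEnd {G : Type*} [Monoid G] : G → G → ℕ → G
  | _, _, 0 => 1
  | a, b, m + 1 => altEnd b a m * b

/-- The class of `z` under the equivalence "being nonzero scalar multiples of each
other" (the class `ẑ`). -/
def rayClass {V : Type*} [AddCommGroup V] [Module ℝ V] (z : V) : Set V :=
  { v | ∃ c : ℝ, c ≠ 0 ∧ v = c • z }

/-- The set `Â = {ẑ : z ∈ A}` of scalar-equivalence classes of elements of `A`. -/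
def rayClasses {V : Type*} [AddCommGroup V] [Module ℝ V] (A : Set V) : Set (Set V) :=
  { C | ∃ z ∈ A, C = rayClass z }

/-- A Coxeter datum `(S, V₁, V₂, Π₁, Π₂, ⟨·,·⟩)` satisfying (D1)–(D5), together with
its associated abstract Coxeter group `W` (a group generated by involutions
`r s`, acting faithfully on `V₁` and `V₂` in the prescribed way, with the pairing
`W`-invariant), the decomposition `Φᵢ = Φᵢ⁺ ⊎ Φᵢ⁻` of the paired root systems, the
`W`-equivariant bijection `φ : Φ₁ → Φ₂` (with inverse `phiInv`), and the reflections
`r_x ∈ T` attached to the roots `x ∈ Φ₁` (`refl₁`) resp. `y ∈ Φ₂` (`refl₂`). -/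
structure CoxeterDatum (S : Type*) (V₁ : Type*) (V₂ : Type*) (W : Type*)
    [AddCommGroup V₁] [Module ℝ V₁] [AddCommGroup V₂] [Module ℝ V₂] [Group W] where
  pair : V₁ →ₗ[ℝ] V₂ →ₗ[ℝ] ℝ
  α : S → V₁
  β : S → V₂
  α_inj : Function.Injective α
  β_inj : Function.Injective β
  D1 : ∀ s, pair (α s) (β s) = 1
  D2a : (0 : V₁) ∉ PLC (Set.range α)
  D2b : (0 : V₂) ∉ PLC (Set.range β)
  D2c : ∀ s, α s ∉ PLC (Set.range α \ {α s})
  D2d : ∀ s, β s ∉ PLC (Set.range β \ {β s})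
  D3 : ∀ s t, s ≠ t → pair (α s) (β t) ≤ 0
  D4 : ∀ s t, pair (α s) (β t) = 0 → pair (α t) (β s) = 0
  D5 : ∀ s t, s ≠ t →
    (∃ m : ℕ, 2 ≤ m ∧ pair (α s) (β t) * pair (α t) (β s) = Real.cos (Real.pi / m) ^ 2) ∨
      1 ≤ pair (α s) (β t) * pair (α t) (β s)
  /-- the Coxeter generators `R = {r s : s ∈ S}` of `W` -/
  r : S → W
  r_gen : Subgroup.closure (Set.range r) = ⊤
  r_ne_one : ∀ s, r s ≠ 1
  r_sq : ∀ s, r s * r s = 1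
  /-- the faithful action of `W` on `V₁` -/
  ρ₁ : W →* Module.End ℝ V₁
  /-- the faithful action of `W` on `V₂` -/
  ρ₂ : W →* Module.End ℝ V₂
  ρ₁_inj : Function.Injective ρ₁
  ρ₂_inj : Function.Injective ρ₂
  hr₁ : ∀ s x, ρ₁ (r s) x = x - (2 * pair x (β s)) • α s
  hr₂ : ∀ s y, ρ₂ (r s) y = y - (2 * pair (α s) y) • β s
  pair_inv : ∀ w x y, pair (ρ₁ w x) (ρ₂ w y) = pair x y
  /-- the `W`-equivariant bijection `φ : Φ₁ → Φ₂` -/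
  phi : V₁ → V₂
  /-- the inverse `φ⁻¹ : Φ₂ → Φ₁` -/
  phiInv : V₂ → V₁
  /-- the reflection `r_x` corresponding to a root `x ∈ Φ₁` -/
  refl₁ : V₁ → W
  /-- the reflection `r_y` corresponding to a root `y ∈ Φ₂` -/
  refl₂ : V₂ → W
  decomp₁ : { v | ∃ w s, v = ρ₁ w (α s) } =
      ({ v | ∃ w s, v = ρ₁ w (α s) } ∩ PLC (Set.range α)) ∪
        (-({ v | ∃ w s, v = ρ₁ w (α s) } ∩ PLC (Set.range α)))
  disj₁ : Disjoint ({ v | ∃ w s, v = ρ₁ w (α s) } ∩ PLC (Set.range α))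
      (-({ v | ∃ w s, v = ρ₁ w (α s) } ∩ PLC (Set.range α)))
  decomp₂ : { v | ∃ w s, v = ρ₂ w (β s) } =
      ({ v | ∃ w s, v = ρ₂ w (β s) } ∩ PLC (Set.range β)) ∪
        (-({ v | ∃ w s, v = ρ₂ w (β s) } ∩ PLC (Set.range β)))
  disj₂ : Disjoint ({ v | ∃ w s, v = ρ₂ w (β s) } ∩ PLC (Set.range β))
      (-({ v | ∃ w s, v = ρ₂ w (β s) } ∩ PLC (Set.range β)))
  phi_mem : ∀ x ∈ { v | ∃ w s, v = ρ₁ w (α s) }, phi x ∈ { v | ∃ w s, v = ρ₂ w (β s) }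
  phiInv_mem : ∀ y ∈ { v | ∃ w s, v = ρ₂ w (β s) }, phiInv y ∈ { v | ∃ w s, v = ρ₁ w (α s) }
  phiInv_phi : ∀ x ∈ { v | ∃ w s, v = ρ₁ w (α s) }, phiInv (phi x) = x
  phi_phiInv : ∀ y ∈ { v | ∃ w s, v = ρ₂ w (β s) }, phi (phiInv y) = y
  phi_simple : ∀ s, phi (α s) = β s
  phi_equiv : ∀ w, ∀ x ∈ { v | ∃ w s, v = ρ₁ w (α s) }, phi (ρ₁ w x) = ρ₂ w (phi x)
  refl₁_eq : ∀ w s, refl₁ (ρ₁ w (α s)) = w * r s * w⁻¹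
  refl₂_eq : ∀ w s, refl₂ (ρ₂ w (β s)) = w * r s * w⁻¹
  refl₁_act : ∀ x ∈ { v | ∃ w s, v = ρ₁ w (α s) }, ∀ v,
      ρ₁ (refl₁ x) v = v - (2 * pair v (phi x)) • x
  refl₂_act : ∀ y ∈ { v | ∃ w s, v = ρ₂ w (β s) }, ∀ v,
      ρ₂ (refl₂ y) v = v - (2 * pair (phiInv y) v) • y

namespace CoxeterDatum

variable {S V₁ V₂ W : Type*} [AddCommGroup V₁] [Module ℝ V₁]
  [AddCommGroup V₂] [Module ℝ V₂] [Group W]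

variable (D : CoxeterDatum S V₁ V₂ W)

/-- The root system `Φ₁ = W Π₁`. -/
def Phi₁ : Set V₁ := { v | ∃ w s, v = D.ρ₁ w (D.α s) }

/-- The root system `Φ₂ = W Π₂`. -/
def Phi₂ : Set V₂ := { v | ∃ w s, v = D.ρ₂ w (D.β s) }

/-- The positive roots `Φ₁⁺ = Φ₁ ∩ PLC Π₁`. -/
def PhiPos₁ : Set V₁ := D.Phi₁ ∩ PLC (Set.range D.α)

/-- The positive roots `Φ₂⁺ = Φ₂ ∩ PLC Π₂`. -/
def PhiPos₂ : Set V₂ := D.Phi₂ ∩ PLC (Set.range D.β)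

/-- The negative roots `Φ₁⁻ = -Φ₁⁺`. -/
def PhiNeg₁ : Set V₁ := -D.PhiPos₁

/-- The negative roots `Φ₂⁻ = -Φ₂⁺`. -/
def PhiNeg₂ : Set V₂ := -D.PhiPos₂

/-- The set `T = ⋃_{w ∈ W} w R w⁻¹` of reflections of `W`. -/
def T : Set W := { t | ∃ w s, t = w * D.r s * w⁻¹ }

/-- The length function `ℓ` of `W` with respect to the Coxeter generators `R`. -/
noncomputable def len (w : W) : ℕ :=
  sInf { n | ∃ l : List S, l.length = n ∧ (l.map D.r).prod = w }

/-- `N̄ w = {t ∈ T : ℓ(w t) < ℓ(w)}`. -/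
noncomputable def Nbar (w : W) : Set W :=
  { t | t ∈ D.T ∧ D.len (w * t) < D.len w }

/-- `N₁ w = {ẑ : z ∈ Φ₁⁺, w z ∈ Φ₁⁻}`. -/
def N₁ (w : W) : Set (Set V₁) :=
  { C | ∃ z, z ∈ D.PhiPos₁ ∧ D.ρ₁ w z ∈ D.PhiNeg₁ ∧ C = rayClass z }

/-- `N₂ w = {ẑ : z ∈ Φ₂⁺, w z ∈ Φ₂⁻}`. -/
def N₂ (w : W) : Set (Set V₂) :=
  { C | ∃ z, z ∈ D.PhiPos₂ ∧ D.ρ₂ w z ∈ D.PhiNeg₂ ∧ C = rayClass z }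

/-- A subgroup `W'` of `W` is a reflection subgroup when `W' = ⟨W' ∩ T⟩`. -/
def IsReflectionSubgroup (W' : Subgroup W) : Prop :=
  W' = Subgroup.closure ((W' : Set W) ∩ D.T)

/-- `Φ₁(W') = {x ∈ Φ₁ : r_x ∈ W'}`. -/
def PhiSub₁ (W' : Subgroup W) : Set V₁ :=
  { x | x ∈ D.Phi₁ ∧ D.refl₁ x ∈ W' }

/-- `Φ₂(W') = {y ∈ Φ₂ : r_y ∈ W'}`. -/
def PhiSub₂ (W' : Subgroup W) : Set V₂ :=
  { y | y ∈ D.Phi₂ ∧ D.refl₂ y ∈ W' }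

/-- The canonical generators `S(W') = {t ∈ T : N̄(t) ∩ W' = {t}}`. -/
noncomputable def SW (W' : Subgroup W) : Set W :=
  { t | t ∈ D.T ∧ D.Nbar t ∩ (W' : Set W) = {t} }

/-- `Δ₁(W') = {x ∈ Φ₁⁺ : r_x ∈ S(W')}`. -/
noncomputable def Delta₁ (W' : Subgroup W) : Set V₁ :=
  { x | x ∈ D.PhiPos₁ ∧ D.refl₁ x ∈ D.SW W' }

/-- `Δ₂(W') = {y ∈ Φ₂⁺ : r_y ∈ S(W')}`. -/
noncomputable def Delta₂ (W' : Subgroup W) : Set V₂ :=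
  { y | y ∈ D.PhiPos₂ ∧ D.refl₂ y ∈ D.SW W' }

/-- The length function `ℓ_{W'}` of a reflection subgroup `W'` with respect to its
canonical generators `S(W')`. -/
noncomputable def lenIn (W' : Subgroup W) (w : W) : ℕ :=
  sInf { n | ∃ l : List W, l.length = n ∧ (∀ t ∈ l, t ∈ D.SW W') ∧ l.prod = w }

end CoxeterDatum

namespace CoxeterDatum

section Aux

variable {S V₁ V₂ W : Type*} [AddCommGroup V₁] [Module ℝ V₁]
  [AddCommGroup V₂] [Module ℝ V₂] [Group W]

variable (D : CoxeterDatum S V₁ V₂ W)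

theorem mem_PLC_iff {V : Type*} [AddCommGroup V] [Module ℝ V] (A : Set V) (v : V) :
    v ∈ PLC A ↔ ∃ c : V →₀ ℝ, (∀ a, 0 ≤ c a) ∧ (∀ a, c a ≠ 0 → a ∈ A) ∧ c ≠ 0 ∧
      v = Finsupp.linearCombination ℝ id c := by
  unfold PLC
  simp only [Set.mem_ofPred_eq, Finsupp.linearCombination_apply, id]
  constructor
  · rintro ⟨c, h1, h2, h3, h4⟩
    exact ⟨c, h1, fun a ha => h2 (by simpa using ha), h3, h4⟩
  · rintro ⟨c, h1, h2, h3, h4⟩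
    exact ⟨c, h1, fun a ha => h2 a (by simpa using ha), h3, h4⟩

theorem PLC_smul {V : Type*} [AddCommGroup V] [Module ℝ V] {A : Set V} {v : V}
    (h : v ∈ PLC A) {k : ℝ} (hk : 0 < k) : k • v ∈ PLC A := by
  rw [mem_PLC_iff] at h ⊢
  obtain ⟨c, h1, h2, h3, h4⟩ := h
  refine ⟨k • c, fun a => ?_, fun a ha => h2 a ?_, ?_, ?_⟩
  · simpa using mul_nonneg hk.le (h1 a)
  · intro h
    simp [h] at ha
  · simp [h3, hk.ne']
  · simp [h4]

theorem PLC_add_combo {V : Type*} [AddCommGroup V] [Module ℝ V] {A : Set V} {d : V →₀ ℝ}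
    (h1 : ∀ a, 0 ≤ d a) (h2 : ∀ a, d a ≠ 0 → a ∈ A) {v : V}
    (h : v ∈ PLC A) : v + Finsupp.linearCombination ℝ id d ∈ PLC A := by
  rw [mem_PLC_iff] at h ⊢
  obtain ⟨c, g1, g2, g3, g4⟩ := h
  refine ⟨c + d, fun a => add_nonneg (g1 a) (h1 a), fun a ha => ?_, ?_, by simp [g4]⟩
  · by_cases hc : c a = 0
    · by_cases hd : d a = 0
      · simp [hc, hd] at ha
      · exact h2 a hd
    · exact g2 a hc
  · intro h0
    apply g3
    ext a
    have := DFunLike.congr_fun h0 a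
    simp at this
    have := g1 a
    have := h1 a
    simp
    linarith

theorem PLC_add {V : Type*} [AddCommGroup V] [Module ℝ V] {A : Set V} {u v : V}
    (h : u ∈ PLC A) (h' : v ∈ PLC A) : u + v ∈ PLC A := by
  rw [mem_PLC_iff] at h'
  obtain ⟨c, g1, g2, g3, rfl⟩ := h'
  exact PLC_add_combo g1 g2 h

theorem PLC_mono {V : Type*} [AddCommGroup V] [Module ℝ V] {A B : Set V} (hAB : A ⊆ B) {u : V}
    (h : u ∈ PLC A) : u ∈ PLC B := by
  rw [mem_PLC_iff] at h ⊢
  obtain ⟨c, g1, g2, g3, g4⟩ := h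
  exact ⟨c, g1, fun a ha => hAB (g2 a ha), g3, g4⟩

theorem simple_pos (s : S) : D.α s ∈ PLC (Set.range D.α) := by
  rw [mem_PLC_iff]
  refine ⟨Finsupp.single (D.α s) 1, fun a => ?_, fun a ha => ?_, by simp, by simp⟩
  · classical
    rw [Finsupp.single_apply]; split_ifs <;> norm_num
  · classical
    rw [Finsupp.single_apply] at ha
    split_ifs at ha with h
    · exact ⟨s, h⟩
    · exact absurd rfl ha

/-- A nonnegative combination of simple roots on the line of `α s` only involves `α s`. -/
theorem combo_line (s : S) (k : ℝ) (c : V₁ →₀ ℝ) (h1 : ∀ a, 0 ≤ c a)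
    (h2 : ∀ a, c a ≠ 0 → a ∈ Set.range D.α)
    (h3 : Finsupp.linearCombination ℝ id c = k • D.α s) :
    ∀ a, a ≠ D.α s → c a = 0 := by
  classical
  by_contra hcon
  push Not at hcon
  obtain ⟨a₀, ha₀, hca₀⟩ := hcon
  have hd : c.erase (D.α s) + Finsupp.single (D.α s) (c (D.α s)) = c :=
    Finsupp.erase_add_single _ _
  have hsum : Finsupp.linearCombination ℝ id (c.erase (D.α s)) =
      (k - c (D.α s)) • D.α s := by
    rw [← hd] at h3
    simp only [map_add, Finsupp.linearCombination_single, id] at h3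
    rw [sub_smul, ← h3]
    simp
  have hmem : (k - c (D.α s)) • D.α s ∈ PLC (Set.range D.α \ {D.α s}) := by
    rw [mem_PLC_iff]
    refine ⟨c.erase (D.α s), fun a => ?_, fun a ha => ?_, ?_, hsum.symm⟩
    · rw [Finsupp.erase_apply]; split_ifs
      · exact le_rfl
      · exact h1 a
    · rw [Finsupp.erase_apply] at ha
      split_ifs at ha with h
      · exact absurd rfl ha
      · exact ⟨h2 a ha, h⟩
    · intro h0
      have := DFunLike.congr_fun h0 a₀
      rw [Finsupp.erase_ne ha₀] at this
      exact hca₀ this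
  rcases lt_trichotomy (k - c (D.α s)) 0 with h | h | h
  · have h5 := PLC_smul (D.simple_pos s) (neg_pos.2 h)
    have h6 := PLC_add h5 (PLC_mono Set.sdiff_subset hmem)
    rw [neg_smul, neg_add_cancel] at h6
    exact D.D2a h6
  · rw [h, zero_smul] at hmem
    exact D.D2a (PLC_mono Set.sdiff_subset hmem)
  · have := PLC_smul hmem (inv_pos.2 h)
    rw [smul_smul, inv_mul_cancel₀ h.ne', one_smul] at this
    exact D.D2c s this

theorem line_of_flip (s : S) (k : ℝ) (y : V₁) (hy : y ∈ PLC (Set.range D.α))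
    (hy' : -(y - k • D.α s) ∈ PLC (Set.range D.α)) : ∃ c : ℝ, c ≠ 0 ∧ y = c • D.α s := by
  rw [mem_PLC_iff] at hy hy'
  obtain ⟨c, g1, g2, g3, g4⟩ := hy
  obtain ⟨d, h1, h2, h3, h4⟩ := hy'
  have key := D.combo_line s k (c + d) (fun a => add_nonneg (g1 a) (h1 a))
    (fun a ha => by
      by_cases hc : c a = 0
      · by_cases hd : d a = 0
        · simp [hc, hd] at ha
        · exact h2 a hd
      · exact g2 a hc)
    (by rw [map_add, ← g4, ← h4]; abel)
  have hc : c = Finsupp.single (D.α s) (c (D.α s)) := by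
    classical
    ext a
    rw [Finsupp.single_apply]
    split_ifs with h
    · rw [h]
    · have := key a (Ne.symm h)
      simp at this
      have := g1 a
      have := h1 a
      linarith
  refine ⟨c (D.α s), ?_, ?_⟩
  · intro h
    rw [h, Finsupp.single_zero] at hc
    exact g3 hc
  · rw [g4]
    conv_lhs => rw [hc]
    simp

theorem not_pos_neg {x : V₁} (h : x ∈ PLC (Set.range D.α)) (h' : -x ∈ PLC (Set.range D.α)) :
    False := by
  have := PLC_add h h'
  rw [add_neg_cancel] at this
  exact D.D2a this

theorem root_simple (s : S) : D.α s ∈ D.Phi₁ := ⟨1, s, by simp⟩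

theorem root_act {x : V₁} (hx : x ∈ D.Phi₁) (w : W) : D.ρ₁ w x ∈ D.Phi₁ := by
  obtain ⟨u, s, rfl⟩ := hx
  exact ⟨w * u, s, by simp⟩

theorem r_simple (s : S) : D.ρ₁ (D.r s) (D.α s) = - D.α s := by
  rw [D.hr₁, D.D1]; module

theorem root_neg {x : V₁} (hx : x ∈ D.Phi₁) : -x ∈ D.Phi₁ := by
  obtain ⟨u, s, rfl⟩ := hx
  exact ⟨u * D.r s, s, by simp [D.r_simple]⟩

theorem pos_or_neg {x : V₁} (hx : x ∈ D.Phi₁) :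
    x ∈ PLC (Set.range D.α) ∨ -x ∈ PLC (Set.range D.α) := by
  have h : x ∈ { v | ∃ w s, v = D.ρ₁ w (D.α s) } := hx
  rw [D.decomp₁] at h
  rcases h with h | h
  · exact Or.inl h.2
  · exact Or.inr h.2

theorem neg_iff {x : V₁} (hx : x ∈ D.Phi₁) :
    -x ∈ PLC (Set.range D.α) ↔ ¬ x ∈ PLC (Set.range D.α) :=
  ⟨fun h h' => D.not_pos_neg h' h, fun h => (D.pos_or_neg hx).resolve_left h⟩

theorem mem_PhiNeg_iff {x : V₁} (hx : x ∈ D.Phi₁) :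
    x ∈ D.PhiNeg₁ ↔ ¬ x ∈ PLC (Set.range D.α) := by
  rw [← D.neg_iff hx]
  exact ⟨fun h => h.2, fun h => ⟨D.root_neg hx, h⟩⟩

theorem refl_act {x : V₁} (hx : x ∈ D.Phi₁) (w : W) :
    D.refl₁ (D.ρ₁ w x) = w * D.refl₁ x * w⁻¹ := by
  obtain ⟨u, s, rfl⟩ := hx
  have : D.ρ₁ w (D.ρ₁ u (D.α s)) = D.ρ₁ (w * u) (D.α s) := by simp
  rw [this, D.refl₁_eq, D.refl₁_eq]
  group

theorem refl_simple (s : S) : D.refl₁ (D.α s) = D.r s := by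
  have := D.refl₁_eq 1 s
  simpa using this

theorem r_inv (s : S) : (D.r s)⁻¹ = D.r s := inv_eq_of_mul_eq_one_left (D.r_sq s)

theorem refl_neg {x : V₁} (hx : x ∈ D.Phi₁) : D.refl₁ (-x) = D.refl₁ x := by
  obtain ⟨u, s, rfl⟩ := hx
  have : -(D.ρ₁ u (D.α s)) = D.ρ₁ (u * D.r s) (D.α s) := by simp [D.r_simple]
  rw [this, D.refl₁_eq, D.refl₁_eq, mul_inv_rev, D.r_inv, mul_assoc u, D.r_sq, mul_one, mul_assoc]

theorem refl_sq {x : V₁} (hx : x ∈ D.Phi₁) : D.refl₁ x * D.refl₁ x = 1 := by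
  obtain ⟨u, s, rfl⟩ := hx
  rw [D.refl₁_eq]
  have := D.r_sq s
  calc u * D.r s * u⁻¹ * (u * D.r s * u⁻¹) = u * (D.r s * D.r s) * u⁻¹ := by group
    _ = 1 := by rw [this]; group

theorem pair_phi {x : V₁} (hx : x ∈ D.Phi₁) : D.pair x (D.phi x) = 1 := by
  obtain ⟨u, s, rfl⟩ := hx
  rw [D.phi_equiv u _ (D.root_simple s), D.pair_inv, D.phi_simple, D.D1]

theorem refl_self {x : V₁} (hx : x ∈ D.Phi₁) : D.ρ₁ (D.refl₁ x) x = -x := by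
  rw [D.refl₁_act x hx, D.pair_phi hx]; module

theorem root_sub_le (s t : S) (hts : t ≠ s) (M : ℝ) (h : D.α t - M • D.α s ∈ D.Phi₁) :
    M ≤ 0 := by
  classical
  have hne : D.α t ≠ D.α s := fun h => hts (D.α_inj h)
  by_contra hM
  push Not at hM
  rcases D.pos_or_neg h with h | h
  · rw [mem_PLC_iff] at h
    obtain ⟨c, g1, g2, g3, g4⟩ := h
    have hs : ∀ a, 0 ≤ Finsupp.single (D.α s) M a := fun a => by
      rw [Finsupp.single_apply]; split_ifs
      · exact hM.le
      · exact le_rfl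
    have := D.combo_line t 1 (c + Finsupp.single (D.α s) M)
      (fun a => add_nonneg (g1 a) (hs a))
      (fun a ha => by
        by_cases has : D.α s = a
        · exact ⟨s, has⟩
        · apply g2
          simpa [Finsupp.single_apply, has] using ha)
      (by rw [map_add, ← g4]; simp) (D.α s) hne.symm
    simp at this
    have := g1 (D.α s)
    linarith
  · obtain ⟨c, hc, h'⟩ := D.line_of_flip s M _ (D.simple_pos t) h
    have := D.combo_line s c (Finsupp.single (D.α t) 1)
      (fun a => by rw [Finsupp.single_apply]; split_ifs <;> norm_num)
      (fun a ha => by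
        rw [Finsupp.single_apply] at ha
        split_ifs at ha with h
        · exact ⟨t, h⟩
        · exact absurd rfl ha)
      (by simpa using h') (D.α t) hne
    simp at this

theorem refl_line (s : S) (c : ℝ) (hx : c • D.α s ∈ D.Phi₁) :
    D.refl₁ (c • D.α s) = D.r s := by
  set y := c • D.α s with hy
  set p := D.phi y with hp
  have hcp : c * D.pair (D.α s) p = 1 := by
    have := D.pair_phi hx
    rw [hy] at this
    simpa using this
  have hact : ∀ v, D.ρ₁ (D.refl₁ y) v = v - (2 * D.pair v p) • y := D.refl₁_act y hx
  have hg : ∀ v, D.ρ₁ (D.r s * D.refl₁ y) v =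
      v - (2 * (D.pair v (D.β s) - c * D.pair v p)) • D.α s := by
    intro v
    rw [map_mul, Module.End.mul_apply, hact, D.hr₁, hy]
    simp only [map_sub, map_smul, LinearMap.sub_apply, LinearMap.smul_apply, smul_eq_mul, D.D1]
    module
  have hg' : ∀ v, D.ρ₁ (D.refl₁ y * D.r s) v =
      v - (-(2 * (D.pair v (D.β s) - c * D.pair v p))) • D.α s := by
    intro v
    rw [map_mul, Module.End.mul_apply, hact, D.hr₁, hy]
    simp only [map_sub, map_smul, LinearMap.sub_apply, LinearMap.smul_apply, smul_eq_mul]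
    have : (2 * (D.pair v p - 2 * D.pair v (D.β s) * D.pair (D.α s) p)) • c • D.α s
        = (2 * (c * D.pair v p) - 4 * D.pair v (D.β s) * (c * D.pair (D.α s) p)) • D.α s := by
      module
    rw [this, hcp]
    module
  have hf : ∀ t, D.pair (D.α t) (D.β s) - c * D.pair (D.α t) p = 0 := by
    intro t
    by_cases hts : t = s
    · rw [hts, D.D1, hcp, sub_self]
    · have h1 := D.root_act (D.root_simple t) (D.r s * D.refl₁ y)
      have h2 := D.root_act (D.root_simple t) (D.refl₁ y * D.r s)
      rw [hg] at h1
      rw [hg'] at h2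
      have := D.root_sub_le s t hts _ h1
      have := D.root_sub_le s t hts _ h2
      linarith
  -- the action on the second space
  have hfix : D.ρ₂ (D.r s * D.refl₁ y) (D.β s) = D.β s := by
    have := D.phi_equiv (D.r s * D.refl₁ y) _ (D.root_simple s)
    rw [hg, hf, mul_zero, zero_smul, sub_zero, D.phi_simple] at this
    exact this.symm
  have hpy : p ∈ D.Phi₂ := D.phi_mem y hx
  have hrefl2 : D.refl₂ p = D.refl₁ y := by
    obtain ⟨u, t, hut⟩ := hx
    have : p = D.ρ₂ u (D.β t) := by
      rw [hp, hut, D.phi_equiv u _ (D.root_simple t), D.phi_simple]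
    rw [this, hut, D.refl₂_eq, D.refl₁_eq]
  have heta : D.β s - c • p = 0 := by
    have h1 : D.ρ₂ (D.refl₁ y) (D.β s) = D.β s - (2 * D.pair y (D.β s)) • p := by
      rw [← hrefl2, D.refl₂_act p hpy]
      rw [hp, D.phiInv_phi y hx]
    rw [map_mul, Module.End.mul_apply, h1, D.hr₂, hy] at hfix
    simp only [map_sub, map_smul, LinearMap.smul_apply, smul_eq_mul, D.D1, mul_one] at hfix
    have e : D.β s - (2 * c) • p - (2 * (1 - 2 * c * D.pair (D.α s) p)) • D.β s =
        D.β s - (2 * c) • p - (2 * (1 - 2 * (c * D.pair (D.α s) p))) • D.β s := by module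
    rw [e, hcp] at hfix
    have h2 : (2 : ℝ) • (D.β s - c • p) = 0 := by
      have h3 := sub_eq_zero.2 hfix
      rw [← h3]; module
    exact (smul_eq_zero.1 h2).resolve_left (by norm_num)
  have hone : D.r s * D.refl₁ y = 1 := by
    apply D.ρ₁_inj
    ext v
    rw [hg, map_one, Module.End.one_apply]
    have : D.pair v (D.β s - c • p) = 0 := by rw [heta, map_zero]
    rw [map_sub, map_smul, smul_eq_mul] at this
    rw [this, mul_zero, zero_smul, sub_zero]
  rw [← D.r_inv s]
  exact eq_inv_of_mul_eq_one_right hone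

theorem refl_of_flip (s : S) {y : V₁} (hy : y ∈ D.Phi₁) (hp : y ∈ PLC (Set.range D.α))
    (hn : ¬ D.ρ₁ (D.r s) y ∈ PLC (Set.range D.α)) : D.refl₁ y = D.r s := by
  rw [← D.neg_iff (D.root_act hy _), D.hr₁] at hn
  obtain ⟨c, -, rfl⟩ := D.line_of_flip s _ y hp hn
  exact D.refl_line s c hy

theorem exchange (l : List S) {x : V₁} (hx : x ∈ D.Phi₁) (hp : x ∈ PLC (Set.range D.α))
    (hn : ¬ D.ρ₁ (l.map D.r).prod x ∈ PLC (Set.range D.α)) :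
    ∃ l' : List S, l'.length + 1 = l.length ∧
      (l'.map D.r).prod = (l.map D.r).prod * D.refl₁ x := by
  induction l with
  | nil => simp at hn; exact absurd hp hn
  | cons s l ih =>
    by_cases h : D.ρ₁ (l.map D.r).prod x ∈ PLC (Set.range D.α)
    · refine ⟨l, rfl, ?_⟩
      rw [List.map_cons, List.prod_cons, map_mul, Module.End.mul_apply] at hn
      have h1 := D.refl_of_flip s (D.root_act hx _) h hn
      rw [D.refl_act hx] at h1
      rw [List.map_cons, List.prod_cons]
      have h2 := D.r_sq s
      calc (l.map D.r).prod = (D.r s * D.r s) * (l.map D.r).prod := by rw [h2, one_mul]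
        _ = D.r s * ((l.map D.r).prod * D.refl₁ x * (l.map D.r).prod⁻¹)
            * (l.map D.r).prod := by rw [h1]
        _ = _ := by group
    · obtain ⟨l', h1, h2⟩ := ih h
      exact ⟨s :: l', by simp [h1], by simp [h2, mul_assoc]⟩

theorem exists_list_closure {G : Type*} [Group G] (A : Set G) (hA : ∀ a ∈ A, a * a = 1) {w : G}
    (hw : w ∈ Subgroup.closure A) : ∃ l : List G, (∀ t ∈ l, t ∈ A) ∧ l.prod = w := by
  induction hw using Subgroup.closure_induction with
  | mem x hx => exact ⟨[x], by simpa using hx, by simp⟩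
  | one => exact ⟨[], by simp, rfl⟩
  | mul x y _ _ hx hy =>
    obtain ⟨l, h1, rfl⟩ := hx
    obtain ⟨l', h1', rfl⟩ := hy
    refine ⟨l ++ l', fun t ht => ?_, by simp⟩
    rcases List.mem_append.1 ht with h | h
    · exact h1 t h
    · exact h1' t h
  | inv x _ hx =>
    obtain ⟨l, h1, rfl⟩ := hx
    refine ⟨l.reverse, fun t ht => h1 t (by simpa using ht), ?_⟩
    rw [List.prod_inv_reverse]
    congr 1
    congr 1
    symm
    refine (List.map_congr_left (g := id) ?_).trans (List.map_id l)
    exact fun a ha => inv_eq_of_mul_eq_one_left (hA a (h1 a ha))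

theorem exists_word (w : W) : ∃ l : List S, (l.map D.r).prod = w := by
  have hw : w ∈ Subgroup.closure (Set.range D.r) := by rw [D.r_gen]; trivial
  obtain ⟨l, h1, h2⟩ := exists_list_closure _ (by rintro _ ⟨s, rfl⟩; exact D.r_sq s) hw
  have : l ∈ Set.range (List.map D.r) := by
    rw [Set.range_list_map]; exact h1
  obtain ⟨l', rfl⟩ := this
  exact ⟨l', h2⟩

theorem len_spec (w : W) : ∃ l : List S, l.length = D.len w ∧ (l.map D.r).prod = w := by
  have : D.len w ∈ { n | ∃ l : List S, l.length = n ∧ (l.map D.r).prod = w } := by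
    apply Nat.sInf_mem
    obtain ⟨l, hl⟩ := D.exists_word w
    exact ⟨l.length, l, rfl, hl⟩
  exact this

theorem len_le (l : List S) : D.len (l.map D.r).prod ≤ l.length :=
  Nat.sInf_le ⟨l, rfl, rfl⟩

theorem len_lt {w : W} {x : V₁} (hx : x ∈ D.Phi₁) (hp : x ∈ PLC (Set.range D.α))
    (hn : ¬ D.ρ₁ w x ∈ PLC (Set.range D.α)) : D.len (w * D.refl₁ x) < D.len w := by
  obtain ⟨l, h1, h2⟩ := D.len_spec w
  rw [← h2] at hn
  obtain ⟨l', h3, h4⟩ := D.exchange l hx hp hn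
  rw [h2] at h4
  have := D.len_le l'
  rw [h4] at this
  omega

theorem refl_mem_T {x : V₁} (hx : x ∈ D.Phi₁) : D.refl₁ x ∈ D.T := by
  obtain ⟨u, s, rfl⟩ := hx
  exact ⟨u, s, D.refl₁_eq u s⟩

theorem Nbar_iff (w : W) {x : V₁} (hx : x ∈ D.Phi₁) (hp : x ∈ PLC (Set.range D.α)) :
    D.refl₁ x ∈ D.Nbar w ↔ ¬ D.ρ₁ w x ∈ PLC (Set.range D.α) := by
  constructor
  · rintro ⟨-, h⟩ hpos
    have h1 : ¬ D.ρ₁ (w * D.refl₁ x) x ∈ PLC (Set.range D.α) := by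
      rw [map_mul, Module.End.mul_apply, D.refl_self hx, map_neg]
      exact fun h => D.not_pos_neg hpos h
    have := D.len_lt hx hp h1
    rw [mul_assoc, D.refl_sq hx, mul_one] at this
    omega
  · intro h
    exact ⟨D.refl_mem_T hx, D.len_lt hx hp h⟩

theorem exists_root {t : W} (ht : t ∈ D.T) :
    ∃ x ∈ D.Phi₁, x ∈ PLC (Set.range D.α) ∧ D.refl₁ x = t := by
  obtain ⟨u, s, rfl⟩ := ht
  have hx := D.root_act (D.root_simple s) u
  rcases D.pos_or_neg hx with h | h
  · exact ⟨_, hx, h, D.refl₁_eq u s⟩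
  · exact ⟨_, D.root_neg hx, h, by rw [D.refl_neg hx, D.refl₁_eq]⟩

theorem T_conj {t : W} (ht : t ∈ D.T) (v : W) : v * t * v⁻¹ ∈ D.T := by
  obtain ⟨u, s, rfl⟩ := ht
  exact ⟨v * u, s, by group⟩

theorem T_sq {t : W} (ht : t ∈ D.T) : t * t = 1 := by
  obtain ⟨x, hx, -, rfl⟩ := D.exists_root ht
  exact D.refl_sq hx

theorem T_inv {t : W} (ht : t ∈ D.T) : t⁻¹ = t := inv_eq_of_mul_eq_one_left (D.T_sq ht)

theorem r_mem_T (s : S) : D.r s ∈ D.T := ⟨1, s, by simp⟩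

theorem cocycle (u v : W) {t : W} (ht : t ∈ D.T) :
    t ∈ D.Nbar (u * v) ↔ ¬ (t ∈ D.Nbar v ↔ v * t * v⁻¹ ∈ D.Nbar u) := by
  obtain ⟨x, hx, hp, rfl⟩ := D.exists_root ht
  have hvx := D.root_act hx v
  have huvx := D.root_act hvx u
  rw [D.Nbar_iff _ hx hp, D.Nbar_iff _ hx hp, ← D.refl_act hx, map_mul, Module.End.mul_apply]
  by_cases h : D.ρ₁ v x ∈ PLC (Set.range D.α)
  · rw [D.Nbar_iff _ hvx h]
    tauto
  · have h' := (D.neg_iff hvx).2 h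
    rw [← D.refl_neg hvx, D.Nbar_iff _ (D.root_neg hvx) h', map_neg, D.neg_iff huvx]
    tauto

theorem not_mem_Nbar_one (t : W) : t ∉ D.Nbar 1 := by
  rintro ⟨ht, h⟩
  have : D.len 1 ≤ 0 := D.len_le []
  omega

theorem Nbar_r (s : S) (t : W) : t ∈ D.Nbar (D.r s) ↔ t = D.r s := by
  constructor
  · intro h
    obtain ⟨x, hx, hp, rfl⟩ := D.exists_root h.1
    rw [D.Nbar_iff _ hx hp] at h
    exact D.refl_of_flip s hx hp h
  · rintro rfl
    have := (D.Nbar_iff (D.r s) (D.root_simple s) (D.simple_pos s)).2 (by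
      rw [D.r_simple]
      exact fun h => D.not_pos_neg (D.simple_pos s) h)
    rwa [D.refl_simple] at this

theorem self_mem_Nbar {t : W} (ht : t ∈ D.T) : t ∈ D.Nbar t := by
  obtain ⟨x, hx, hp, rfl⟩ := D.exists_root ht
  rw [D.Nbar_iff _ hx hp, D.refl_self hx]
  exact fun h => D.not_pos_neg hp h

theorem SW_mem {W' : Subgroup W} {t : W} (ht : t ∈ D.SW W') : t ∈ W' := by
  have : t ∈ D.Nbar t ∩ (W' : Set W) := by rw [ht.2]; rfl
  exact this.2

theorem r_mem_SW {W' : Subgroup W} {s : S} (h : D.r s ∈ W') : D.r s ∈ D.SW W' := by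
  refine ⟨D.r_mem_T s, ?_⟩
  ext t
  constructor
  · rintro ⟨h1, -⟩
    exact (D.Nbar_r s t).1 h1
  · intro ht
    rw [Set.mem_singleton_iff] at ht
    rw [ht]
    exact ⟨(D.Nbar_r s _).2 rfl, h⟩

theorem Nbar_conj {W' : Subgroup W} {s : S} (h : D.r s ∉ W') {x t : W} (hx : x ∈ W')
    (htW : t ∈ W') (ht : t ∈ D.T) :
    D.r s * t * D.r s ∈ D.Nbar (D.r s * x * D.r s) ↔ t ∈ D.Nbar x := by
  have hrt : D.r s * t * D.r s ∈ D.T := by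
    have := D.T_conj ht (D.r s)
    rwa [D.r_inv] at this
  have e : D.r s * (D.r s * t * D.r s) * (D.r s)⁻¹ = t := by
    have h2 := D.r_sq s
    calc _ = (D.r s * D.r s) * t * (D.r s * (D.r s)⁻¹) := by group
      _ = t := by rw [h2]; group
  have hne : ¬ D.r s * t * D.r s = D.r s := by
    intro h'
    have h1 : D.r s * t = 1 := by simpa using h'
    have h2 : t = D.r s := by
      rw [← D.r_inv s]; exact eq_inv_of_mul_eq_one_right h1
    exact h (h2 ▸ htW)
  have hne' : ¬ x * t * x⁻¹ = D.r s := fun h' =>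
    h (h' ▸ W'.mul_mem (W'.mul_mem hx htW) (W'.inv_mem hx))
  rw [D.cocycle (D.r s * x) (D.r s) hrt, e, D.cocycle (D.r s) x ht, D.Nbar_r, D.Nbar_r]
  tauto

/-- If `t ∈ S(r W' r)` and `r ∉ W'` then `r t r ∈ S(W')`. -/
theorem SW_conj {W' W'' : Subgroup W} {s : S} (h : D.r s ∉ W')
    (hW : ∀ g, g ∈ W'' ↔ D.r s * g * D.r s ∈ W') {t : W} (ht : t ∈ D.SW W'') :
    D.r s * t * D.r s ∈ D.SW W' := by
  have hrr : ∀ g, D.r s * (D.r s * g * D.r s) * D.r s = g := fun g => by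
    have h2 := D.r_sq s
    calc _ = (D.r s * D.r s) * g * (D.r s * D.r s) := by group
      _ = g := by rw [h2]; group
  have hTc : ∀ g ∈ D.T, D.r s * g * D.r s ∈ D.T := fun g hg => by
    have := D.T_conj hg (D.r s)
    rwa [D.r_inv] at this
  have htW' := (hW t).1 (D.SW_mem ht)
  have hT := hTc t ht.1
  refine ⟨hT, ?_⟩
  ext g
  constructor
  · rintro ⟨h1, h2⟩
    have h3 := (D.Nbar_conj h htW' h2 h1.1).2 h1
    rw [hrr] at h3
    have h4 : D.r s * g * D.r s ∈ D.Nbar t ∩ (W'' : Set W) :=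
      ⟨h3, (hW _).2 (by rw [hrr]; exact h2)⟩
    rw [ht.2, Set.mem_singleton_iff] at h4
    rw [Set.mem_singleton_iff, ← h4, hrr]
  · intro hg
    rw [Set.mem_singleton_iff] at hg
    rw [hg]
    exact ⟨D.self_mem_Nbar hT, htW'⟩

theorem refl_mem_closure (l : List S) (s : S) : ∀ (W' : Subgroup W),
    (l.map D.r).prod * D.r s * (l.map D.r).prod⁻¹ ∈ W' →
    (l.map D.r).prod * D.r s * (l.map D.r).prod⁻¹ ∈ Subgroup.closure (D.SW W') := by
  induction l with
  | nil =>
    intro W' h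
    simp at h ⊢
    exact Subgroup.subset_closure (D.r_mem_SW h)
  | cons a l ih =>
    intro W' h
    set t := (l.map D.r).prod * D.r s * (l.map D.r).prod⁻¹ with ht
    have e : ((a :: l).map D.r).prod * D.r s * ((a :: l).map D.r).prod⁻¹
        = D.r a * t * D.r a := by
      rw [List.map_cons, List.prod_cons, mul_inv_rev, D.r_inv, ht]
      simp only [mul_assoc]
    rw [e] at h ⊢
    have hrr : ∀ g, D.r a * (D.r a * g * D.r a) * D.r a = g := fun g => by
      have h2 := D.r_sq a
      calc _ = (D.r a * D.r a) * g * (D.r a * D.r a) := by group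
        _ = g := by rw [h2]; group
    by_cases ha : D.r a ∈ W'
    · have h1 : t ∈ W' := by
        rw [← hrr t]; exact W'.mul_mem (W'.mul_mem ha h) ha
      have h2 := Subgroup.subset_closure (D.r_mem_SW ha)
      exact Subgroup.mul_mem _ (Subgroup.mul_mem _ h2 (ih W' h1)) h2
    · have hW : ∀ g, g ∈ W'.comap (MulAut.conj (D.r a)).toMonoidHom ↔
          D.r a * g * D.r a ∈ W' := fun g => by
        simp [Subgroup.mem_comap, D.r_inv]
      have h1 := ih (W'.comap (MulAut.conj (D.r a)).toMonoidHom) ((hW t).2 h)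
      have h2 : Subgroup.closure (D.SW (W'.comap (MulAut.conj (D.r a)).toMonoidHom)) ≤
          (Subgroup.closure (D.SW W')).comap (MulAut.conj (D.r a)).toMonoidHom := by
        rw [Subgroup.closure_le]
        intro g hg
        have := Subgroup.subset_closure (D.SW_conj ha hW hg)
        simpa [Subgroup.mem_comap, D.r_inv] using this
      have h3 := h2 h1
      simpa [Subgroup.mem_comap, D.r_inv] using h3

theorem exists_word_in {W' : Subgroup W} (hW' : D.IsReflectionSubgroup W') {w : W}
    (hw : w ∈ W') : ∃ l : List W, (∀ t ∈ l, t ∈ D.SW W') ∧ l.prod = w := by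
  apply exists_list_closure _ (fun a ha => D.T_sq ha.1)
  have : W' ≤ Subgroup.closure (D.SW W') := by
    conv_lhs => rw [hW']
    rw [Subgroup.closure_le]
    rintro t ⟨h1, u, s, rfl⟩
    obtain ⟨l, rfl⟩ := D.exists_word u
    exact D.refl_mem_closure l s W' h1
  exact this hw

theorem exchange_in {W' : Subgroup W} (l : List W) (hl : ∀ t ∈ l, t ∈ D.SW W') {t : W}
    (htW : t ∈ W') (hn : t ∈ D.Nbar l.prod) :
    ∃ l' : List W, l'.length + 1 = l.length ∧ (∀ t ∈ l', t ∈ D.SW W') ∧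
      l'.prod = l.prod * t := by
  induction l with
  | nil => exact absurd hn (D.not_mem_Nbar_one t)
  | cons a l ih =>
    have ha : a ∈ D.SW W' := hl a (by simp)
    have hl' : ∀ t ∈ l, t ∈ D.SW W' := fun t ht => hl t (by simp [ht])
    have hlW : l.prod ∈ W' := W'.list_prod_mem (fun t ht => D.SW_mem (hl' t ht))
    by_cases h : t ∈ D.Nbar l.prod
    · obtain ⟨l', h1, h2, h3⟩ := ih hl' h
      refine ⟨a :: l', by simp [h1], ?_, by simp [h3, mul_assoc]⟩
      intro b hb
      rcases List.mem_cons.1 hb with rfl | hb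
      · exact ha
      · exact h2 b hb
    · refine ⟨l, rfl, hl', ?_⟩
      have hT := hn.1
      rw [List.prod_cons, D.cocycle _ _ hT] at hn
      have h1 : l.prod * t * l.prod⁻¹ ∈ D.Nbar a ∩ (W' : Set W) :=
        ⟨by tauto, W'.mul_mem (W'.mul_mem hlW htW) (W'.inv_mem hlW)⟩
      rw [ha.2, Set.mem_singleton_iff] at h1
      have h2 := D.T_sq ha.1
      rw [List.prod_cons]
      calc l.prod = (a * a) * l.prod := by rw [h2, one_mul]
        _ = a * (l.prod * t * l.prod⁻¹) * l.prod := by rw [h1]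
        _ = _ := by group

theorem lenIn_lt {W' : Subgroup W} (hW' : D.IsReflectionSubgroup W') {w : W}
    (hw : w ∈ W') {t : W} (htW : t ∈ W') (hn : t ∈ D.Nbar w) :
    D.lenIn W' (w * t) < D.lenIn W' w := by
  have : D.lenIn W' w ∈
      { n | ∃ l : List W, l.length = n ∧ (∀ t ∈ l, t ∈ D.SW W') ∧ l.prod = w } := by
    apply Nat.sInf_mem
    obtain ⟨l, hl, hl'⟩ := D.exists_word_in hW' hw
    exact ⟨l.length, l, rfl, hl, hl'⟩
  obtain ⟨l, h1, h2, h3⟩ := this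
  rw [← h3] at hn
  obtain ⟨l', h4, h5, h6⟩ := D.exchange_in l h2 htW hn
  have : D.lenIn W' (w * t) ≤ l'.length := Nat.sInf_le ⟨l', rfl, h5, by rw [h6, h3]⟩
  omega

theorem lenIn_iff {W' : Subgroup W} (hW' : D.IsReflectionSubgroup W') {w : W}
    (hw : w ∈ W') {t : W} (htW : t ∈ W') (hT : t ∈ D.T) :
    D.lenIn W' (w * t) < D.lenIn W' w ↔ t ∈ D.Nbar w := by
  refine ⟨fun h => ?_, D.lenIn_lt hW' hw htW⟩
  by_contra hn
  have h1 : t ∈ D.Nbar (w * t) := by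
    rw [D.cocycle _ _ hT, mul_inv_cancel_right]
    have := D.self_mem_Nbar hT
    tauto
  have := D.lenIn_lt hW' (W'.mul_mem hw htW) htW h1
  rw [mul_assoc, D.T_sq hT, mul_one] at this
  omega

theorem mem_rayClass_self {V : Type*} [AddCommGroup V] [Module ℝ V] (z : V) : z ∈ rayClass z :=
  ⟨1, one_ne_zero, by simp⟩

theorem rayClass_neg {V : Type*} [AddCommGroup V] [Module ℝ V] (z : V) :
    rayClass (-z) = rayClass z := by
  ext v
  constructor
  · rintro ⟨c, hc, rfl⟩; exact ⟨-c, neg_ne_zero.2 hc, by simp⟩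
  · rintro ⟨c, hc, rfl⟩; exact ⟨-c, neg_ne_zero.2 hc, by simp⟩

theorem part_one (W' : Subgroup W) (hW' : D.IsReflectionSubgroup W') (w : W) (hw : w ∈ W') :
    D.N₁ w ∩ rayClasses (D.PhiSub₁ W') =
      { C | ∃ x ∈ D.PhiSub₁ W', C = rayClass x ∧
        D.lenIn W' (w * D.refl₁ x) < D.lenIn W' w } := by
  have main : ∀ x ∈ D.PhiSub₁ W', x ∈ PLC (Set.range D.α) →
      (D.lenIn W' (w * D.refl₁ x) < D.lenIn W' w ↔ D.ρ₁ w x ∈ D.PhiNeg₁) := by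
    intro x hx hp
    rw [D.lenIn_iff hW' hw hx.2 (D.refl_mem_T hx.1), D.Nbar_iff w hx.1 hp,
      D.mem_PhiNeg_iff (D.root_act hx.1 w)]
  have hneg : ∀ x ∈ D.PhiSub₁ W', -x ∈ D.PhiSub₁ W' := fun x hx =>
    ⟨D.root_neg hx.1, by rw [D.refl_neg hx.1]; exact hx.2⟩
  ext C
  constructor
  · rintro ⟨⟨z, hz, hwz, hC⟩, x', hx', hC'⟩
    obtain ⟨x, hx, hp, hCx⟩ : ∃ x ∈ D.PhiSub₁ W', x ∈ PLC (Set.range D.α) ∧ C = rayClass x := by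
      rcases D.pos_or_neg hx'.1 with h | h
      · exact ⟨x', hx', h, hC'⟩
      · exact ⟨-x', hneg x' hx', h, by rw [rayClass_neg, hC']⟩
    refine ⟨x, hx, hCx, (main x hx hp).2 ?_⟩
    have hxz : x ∈ rayClass z := by rw [← hC, hCx]; exact mem_rayClass_self x
    obtain ⟨c, hc, rfl⟩ := hxz
    have hcpos : 0 < c := by
      rcases lt_or_gt_of_ne hc with h | h
      · exfalso
        apply D.not_pos_neg hp
        rw [← neg_smul]
        exact PLC_smul hz.2 (neg_pos.2 h)
      · exact h
    rw [D.mem_PhiNeg_iff (D.root_act hx.1 w), ← D.neg_iff (D.root_act hx.1 w), map_smul, ← smul_neg]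
    exact PLC_smul hwz.2 hcpos
  · rintro ⟨x', hx', hC, hlt⟩
    obtain ⟨x, hx, hp, hCx, hlt⟩ : ∃ x ∈ D.PhiSub₁ W', x ∈ PLC (Set.range D.α) ∧
        C = rayClass x ∧ D.lenIn W' (w * D.refl₁ x) < D.lenIn W' w := by
      rcases D.pos_or_neg hx'.1 with h | h
      · exact ⟨x', hx', h, hC, hlt⟩
      · exact ⟨-x', hneg x' hx', h, by rw [rayClass_neg, hC], by rw [D.refl_neg hx'.1]; exact hlt⟩
    exact ⟨⟨x, ⟨hx.1, hp⟩, (main x hx hp).1 hlt, hCx⟩, x, hx, hCx⟩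

/-- The datum with the roles of the two spaces exchanged. -/
def swap : CoxeterDatum S V₂ V₁ W where
  pair := D.pair.flip
  α := D.β
  β := D.α
  α_inj := D.β_inj
  β_inj := D.α_inj
  D1 := fun s => D.D1 s
  D2a := D.D2b
  D2b := D.D2a
  D2c := D.D2d
  D2d := D.D2c
  D3 := fun s t h => D.D3 t s h.symm
  D4 := fun s t h => D.D4 t s h
  D5 := fun s t h => D.D5 t s h.symm
  r := D.r
  r_gen := D.r_gen
  r_ne_one := D.r_ne_one
  r_sq := D.r_sq
  ρ₁ := D.ρ₂
  ρ₂ := D.ρ₁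
  ρ₁_inj := D.ρ₂_inj
  ρ₂_inj := D.ρ₁_inj
  hr₁ := fun s x => D.hr₂ s x
  hr₂ := fun s x => D.hr₁ s x
  pair_inv := fun w x y => D.pair_inv w y x
  phi := D.phiInv
  phiInv := D.phi
  refl₁ := D.refl₂
  refl₂ := D.refl₁
  decomp₁ := D.decomp₂
  disj₁ := D.disj₂
  decomp₂ := D.decomp₁
  disj₂ := D.disj₁
  phi_mem := D.phiInv_mem
  phiInv_mem := D.phi_mem
  phiInv_phi := D.phi_phiInv
  phi_phiInv := D.phiInv_phi
  phi_simple := fun s => by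
    rw [← D.phi_simple s, D.phiInv_phi _ (D.root_simple s)]
  phi_equiv := fun w y hy => by
    have hx := D.phiInv_mem y hy
    have h1 := D.phi_equiv w _ hx
    rw [D.phi_phiInv y hy] at h1
    rw [← h1, D.phiInv_phi _ (D.root_act hx w)]
  refl₁_eq := D.refl₂_eq
  refl₂_eq := D.refl₁_eq
  refl₁_act := D.refl₂_act
  refl₂_act := D.refl₁_act

end Aux

end CoxeterDatum

/-- Let `W'` be a reflection subgroup of `W`, `i ∈ {1,2}`, and
`w ∈ W'`.  Then `Nᵢ(w) ∩ Φ̂ᵢ(W') = {x̂ ∈ Φ̂ᵢ(W') : ℓ_{W'}(w rₓ) < ℓ_{W'}(w)}`. -/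
theorem stmt16 {S V₁ V₂ W : Type*} [AddCommGroup V₁] [Module ℝ V₁]
    [AddCommGroup V₂] [Module ℝ V₂] [Group W]
    (D : CoxeterDatum S V₁ V₂ W)
    (W' : Subgroup W) (hW' : D.IsReflectionSubgroup W') (w : W) (hw : w ∈ W') :
    D.N₁ w ∩ rayClasses (D.PhiSub₁ W') =
      { C | ∃ x ∈ D.PhiSub₁ W', C = rayClass x ∧
        D.lenIn W' (w * D.refl₁ x) < D.lenIn W' w } ∧
    D.N₂ w ∩ rayClasses (D.PhiSub₂ W') =
      { C | ∃ y ∈ D.PhiSub₂ W', C = rayClass y ∧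
        D.lenIn W' (w * D.refl₂ y) < D.lenIn W' w } := by
  exact ⟨D.part_one W' hW' w hw, D.swap.part_one W' hW' w hw⟩
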